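/- For every base-3/2 digit string x there exist a natural number k and a two-free base-3/2 digit string d with v(x) = v(d) + 2k; that is, every integer-like number belongs to one of the sets S_k = {v(d) + 2k : d two-free}. -/

import Mathlib

/-- The value of a base-3/2 digit string. -/
def val32 (d : ℕ →₀ ℕ) : ℚ := d.sum fun i c => (c : ℚ) * (3 / 2 : ℚ) ^ i

/-- A digit string is two-free if all of its digits are 0 or 1. -/
def TwoFree (d : ℕ →₀ ℕ) : Prop := ∀ i, d i ≤ 1

theorem val32_add (d e : ℕ →₀ ℕ) : val32 (d + e) = val32 d + val32 e :=
  Finsupp.sum_add_index' (by simp) (by intros; push_cast; ring)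

theorem val32_single (i c : ℕ) : val32 (Finsupp.single i c) = c * (3 / 2 : ℚ) ^ i :=
  Finsupp.sum_single_index (by simp)

theorem val32_eq_sum_range {d : ℕ →₀ ℕ} {n : ℕ} (hd : d.support ⊆ Finset.range n) :
    val32 d = ∑ i ∈ Finset.range n, (d i : ℚ) * (3 / 2 : ℚ) ^ i :=
  Finsupp.sum_of_support_subset d hd _ (by simp)

/-- Working from the top position down, every pair of units at position `i + 1` is traded for
three units at position `i`; here `a` is the number of pairs carried into position `n - 1`. -/
theorem exists_twoFree_sum_range_add_carry (f : ℕ → ℕ) (n a : ℕ) :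
    ∃ (k : ℕ) (d : ℕ →₀ ℕ), TwoFree d ∧ (∀ i, n ≤ i → d i = 0) ∧
      ∑ i ∈ Finset.range n, (f i : ℚ) * (3 / 2 : ℚ) ^ i + 2 * a * (3 / 2 : ℚ) ^ n =
        val32 d + 2 * k := by
  induction n generalizing a with
  | zero => exact ⟨a, 0, by simp [TwoFree], by simp, by simp [val32]⟩
  | succ n ih =>
    obtain ⟨k, d, hd, hd0, h⟩ := ih ((f n + 3 * a) / 2)
    refine ⟨k, d + Finsupp.single n ((f n + 3 * a) % 2), fun i => ?_, fun i hi => ?_, ?_⟩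
    · rcases eq_or_ne n i with rfl | hi
      · have := hd0 n le_rfl
        simp only [Finsupp.add_apply, Finsupp.single_eq_same]
        omega
      · simpa [Finsupp.single_apply, hi] using hd i
    · have hni : n ≠ i := by omega
      simpa [Finsupp.single_apply, hni] using hd0 i (by omega)
    · have hdiv : (2 : ℚ) * ((f n + 3 * a) / 2 : ℕ) + ((f n + 3 * a) % 2 : ℕ) = f n + 3 * a := by
        exact_mod_cast Nat.div_add_mod (f n + 3 * a) 2
      rw [Finset.sum_range_succ, val32_add, val32_single, pow_succ]
      linear_combination h - (3 / 2 : ℚ) ^ n * hdiv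

/-- Every integer-like number belongs to one of the sets
`S_k = {v(d) + 2k : d two-free}`. -/
theorem every_integer_like_in_some_Sk (x : ℕ →₀ ℕ) (hx : ∀ i, x i ≤ 2) :
    ∃ (k : ℕ) (d : ℕ →₀ ℕ), TwoFree d ∧ val32 x = val32 d + 2 * k := by
  obtain ⟨n, hn⟩ := x.support.exists_nat_subset_range
  obtain ⟨k, d, hd, -, h⟩ := exists_twoFree_sum_range_add_carry x n 0
  exact ⟨k, d, hd, by simpa [val32_eq_sum_range hn] using h⟩
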